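/- arXiv:2401.06574 — 3 statements merged into one kernel-verified Lean document; each statement's English description precedes it below -/
import Mathlib

section
/- Robust dynamic programming, maximizing adversary (correctness of the upper-bound value iteration on the interval MDP). Let S and A be nonempty finite types, d ∈ ℕ, w : S → ℝ, and ℓ, u : Fin d → S → A → S → ℝ with 0 ≤ ℓ k s a s' ≤ u k s a s' for all k, s, a, s'. For each k, s, a let D k s a := { p : S → ℝ | (∀ s', ℓ k s a s' ≤ p s' ∧ p s' ≤ u k s a s') ∧ ∑ s', p s' = 1 } and assume each D k s a is nonempty. An adversary is a map η : Fin d → S → A → (S → ℝ) with η k s a ∈ D k s a for all k, s, a. For a policy σ : Fin d → S → A, an adversary η, and s₀ ∈ S, define Val σ η s₀ := ∑ over (s_1, …, s_d) ∈ S^d of (∏_{k=1}^{d} η (k−1) s_{k−1} (σ (k−1) s_{k−1}) s_k) · w s_d. Define V̄ : Fin (d+1) → S → ℝ by V̄ d s = w s and, for k < d, V̄ k s = max over a ∈ A of sSup { ∑ s', p s' * V̄ (k+1) s' | p ∈ D k s a }. Then the supremum over all policies σ and all adversaries η of Val σ η s₀ is attained and equals V̄ 0 s₀. -/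
/-- Expected terminal weight, from state `s`, of the length-`d` chain with transition weights `P`,
as a sum over all paths. -/
def pathSum {S : Type*} [Fintype S] {d : ℕ} (P : Fin d → S → S → ℝ) (w : S → ℝ) (s : S) : ℝ :=
  ∑ g : Fin d → S,
    (∏ k : Fin d, P k (Matrix.vecCons s g k.castSucc) (Matrix.vecCons s g k.succ)) *
      w (Matrix.vecCons s g (Fin.last d))

theorem pathSum_zero {S : Type*} [Fintype S] (P : Fin 0 → S → S → ℝ) (w : S → ℝ) (s : S) :
    pathSum P w s = w s := by
  simp [pathSum]

theorem pathSum_succ {S : Type*} [Fintype S] {d : ℕ} (P : Fin (d + 1) → S → S → ℝ) (w : S → ℝ)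
    (s : S) :
    pathSum P w s = ∑ s', P 0 s s' * pathSum (fun k => P k.succ) w s' := by
  simp only [pathSum]
  rw [← (Fin.consEquiv fun _ : Fin (d + 1) => S).sum_comp, Fintype.sum_prod_type]
  refine Finset.sum_congr rfl fun s' _ => ?_
  rw [Finset.mul_sum]
  refine Finset.sum_congr rfl fun g _ => ?_
  rw [Fin.prod_univ_succ, mul_assoc]
  rfl

theorem pathSum_le {S : Type*} [Fintype S] {d : ℕ} (P : Fin d → S → S → ℝ) (w : S → ℝ)
    (V : Fin (d + 1) → S → ℝ) (hP : ∀ k s s', 0 ≤ P k s s') (hlast : ∀ s, V (Fin.last d) s = w s)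
    (hV : ∀ k s, ∑ s', P k s s' * V k.succ s' ≤ V k.castSucc s) (s : S) :
    pathSum P w s ≤ V 0 s := by
  induction d generalizing s with
  | zero => rw [pathSum_zero, ← hlast]; rfl
  | succ d ih =>
    rw [pathSum_succ]
    refine le_trans (Finset.sum_le_sum fun s' _ => mul_le_mul_of_nonneg_left ?_ (hP 0 s s')) (hV 0 s)
    exact ih (fun k => P k.succ) (fun k => V k.succ) (fun k => hP k.succ) hlast
      (fun k => hV k.succ) s'

theorem pathSum_eq {S : Type*} [Fintype S] {d : ℕ} (P : Fin d → S → S → ℝ) (w : S → ℝ)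
    (V : Fin (d + 1) → S → ℝ) (hlast : ∀ s, V (Fin.last d) s = w s)
    (hV : ∀ k s, ∑ s', P k s s' * V k.succ s' = V k.castSucc s) (s : S) :
    pathSum P w s = V 0 s := by
  induction d generalizing s with
  | zero => rw [pathSum_zero, ← hlast]; rfl
  | succ d ih =>
    rw [pathSum_succ]
    refine (Finset.sum_congr rfl fun s' _ => ?_).trans (hV 0 s)
    rw [ih (fun k => P k.succ) (fun k => V k.succ) hlast (fun k => hV k.succ) s']

theorem isCompact_intervalDistributions {S : Type*} [Fintype S] (l u : S → ℝ) :
    IsCompact {p : S → ℝ | (∀ s, l s ≤ p s ∧ p s ≤ u s) ∧ ∑ s, p s = 1} := by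
  refine (isCompact_Icc (a := l) (b := u)).of_isClosed_subset ?_
    fun p hp => ⟨fun s => (hp.1 s).1, fun s => (hp.1 s).2⟩
  have h : IsClosed {p : S → ℝ | ∑ s, p s = 1} := isClosed_eq (by fun_prop) continuous_const
  convert (isClosed_Icc (a := l) (b := u)).inter h using 1
  ext p
  simp [Pi.le_def, forall_and]

theorem IsCompact.exists_isGreatest_expectation {S : Type*} [Fintype S] {K : Set (S → ℝ)}
    (hK : IsCompact K) (hne : K.Nonempty) (v : S → ℝ) :
    ∃ p ∈ K, IsGreatest {x : ℝ | ∃ p ∈ K, x = ∑ s, p s * v s} (∑ s, p s * v s) := by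
  obtain ⟨p, hp, hmax⟩ := hK.exists_isMaxOn hne
    (f := fun p : S → ℝ => ∑ s, p s * v s) (by fun_prop)
  refine ⟨p, hp, ⟨p, hp, rfl⟩, ?_⟩
  rintro _ ⟨q, hq, rfl⟩
  exact hmax hq


/-- Robust dynamic programming with a maximizing adversary: the robust
backward value-iteration function `V` (with `sSup` over the feasible interval distributions)
satisfies: the supremum over all policies and all adversaries of the expected terminal
weight from `s₀` is attained and equals `V 0 s₀`. -/
theorem robust_dp_max {S A : Type*} [Fintype S] [Nonempty S] [Fintype A] [Nonempty A]
    (d : ℕ) (w : S → ℝ)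
    (l u : Fin d → S → A → S → ℝ)
    (hlu : ∀ (k : Fin d) (s : S) (a : A) (s' : S), 0 ≤ l k s a s' ∧ l k s a s' ≤ u k s a s')
    (D : Fin d → S → A → Set (S → ℝ))
    (hD : ∀ (k : Fin d) (s : S) (a : A), D k s a =
      {p : S → ℝ | (∀ s' : S, l k s a s' ≤ p s' ∧ p s' ≤ u k s a s') ∧ ∑ s' : S, p s' = 1})
    (hDne : ∀ (k : Fin d) (s : S) (a : A), (D k s a).Nonempty)
    (Val : (Fin d → S → A) → (Fin d → S → A → S → ℝ) → S → ℝ)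
    (hVal : ∀ (σ : Fin d → S → A) (η : Fin d → S → A → S → ℝ) (s₀ : S), Val σ η s₀ =
      ∑ g : Fin d → S,
        (∏ k : Fin d,
          η k (Matrix.vecCons s₀ g k.castSucc) (σ k (Matrix.vecCons s₀ g k.castSucc))
            (Matrix.vecCons s₀ g k.succ)) *
          w (Matrix.vecCons s₀ g (Fin.last d)))
    (V : Fin (d + 1) → S → ℝ)
    (hVlast : ∀ s : S, V (Fin.last d) s = w s)
    (hVrec : ∀ (k : Fin d) (s : S),
      V k.castSucc s = Finset.univ.sup' Finset.univ_nonempty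
        (fun a : A => sSup {x : ℝ | ∃ p ∈ D k s a, x = ∑ s' : S, p s' * V k.succ s'}))
    (s₀ : S) :
    IsGreatest {x : ℝ | ∃ (σ : Fin d → S → A) (η : Fin d → S → A → S → ℝ),
        (∀ (k : Fin d) (s : S) (a : A), η k s a ∈ D k s a) ∧ Val σ η s₀ = x}
      (V 0 s₀) := by
  have hgreat : ∀ k s a, ∃ p ∈ D k s a, IsGreatest
      {x : ℝ | ∃ p ∈ D k s a, x = ∑ s', p s' * V k.succ s'} (∑ s', p s' * V k.succ s') :=
    fun k s a => IsCompact.exists_isGreatest_expectation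
      (hD k s a ▸ isCompact_intervalDistributions (l k s a) (u k s a)) (hDne k s a) _
  choose η hη hη_max using hgreat
  have hσ : ∀ k s, ∃ a, V k.castSucc s = ∑ s', η k s a s' * V k.succ s' := by
    intro k s
    obtain ⟨a, -, ha⟩ := Finset.exists_mem_eq_sup' (Finset.univ_nonempty (α := A))
      fun a => sSup {x : ℝ | ∃ p ∈ D k s a, x = ∑ s' : S, p s' * V k.succ s'}
    exact ⟨a, by rw [hVrec, ha, (hη_max k s a).csSup_eq]⟩
  choose σ hσ using hσ
  have hVal' : ∀ σ η s, Val σ η s = pathSum (fun k s => η k s (σ k s)) w s := hVal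
  refine ⟨⟨σ, η, hη, ?_⟩, ?_⟩
  · rw [hVal']
    exact pathSum_eq _ w V hVlast (fun k s => (hσ k s).symm) s₀
  · rintro _ ⟨τ, ξ, hξ, rfl⟩
    rw [hVal']
    refine pathSum_le _ w V (fun k s s' => ?_) hVlast (fun k s => ?_) s₀
    · have h := hξ k s (τ k s)
      rw [hD] at h
      exact (hlu k s (τ k s) s').1.trans (h.1 s').1
    · rw [hVrec]
      refine le_trans ?_ (Finset.le_sup' _ (Finset.mem_univ (τ k s)))
      exact le_csSup (hη_max k s (τ k s)).bddAbove ⟨_, hξ k s (τ k s), rfl⟩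
end

section
/- Robust dynamic programming, minimizing adversary (correctness of the lower-bound value iteration on the interval MDP). Let S and A be nonempty finite types, d ∈ ℕ, w : S → ℝ, and ℓ, u : Fin d → S → A → S → ℝ with 0 ≤ ℓ k s a s' ≤ u k s a s' for all k, s, a, s'. For each k, s, a let D k s a := { p : S → ℝ | (∀ s', ℓ k s a s' ≤ p s' ∧ p s' ≤ u k s a s') ∧ ∑ s', p s' = 1 } and assume each D k s a is nonempty. For a policy σ : Fin d → S → A and an adversary η (a map with η k s a ∈ D k s a for all k, s, a), define Val σ η s₀ := ∑ over (s_1, …, s_d) ∈ S^d of (∏_{k=1}^{d} η (k−1) s_{k−1} (σ (k−1) s_{k−1}) s_k) · w s_d. Define V̲ : Fin (d+1) → S → ℝ by V̲ d s = w s and, for k < d, V̲ k s = max over a ∈ A of sInf { ∑ s', p s' * V̲ (k+1) s' | p ∈ D k s a }. Then the supremum over all policies σ of the infimum over all adversaries η of Val σ η s₀ equals V̲ 0 s₀. -/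
/-- Expected terminal weight of the length-`d` chain with transition weights `P` started at `s₀`. -/
def chainValue {S : Type*} [Fintype S] {d : ℕ} (P : Fin d → S → S → ℝ) (w : S → ℝ) (s₀ : S) : ℝ :=
  ∑ g : Fin d → S,
    (∏ k : Fin d, P k (Matrix.vecCons s₀ g k.castSucc) (Matrix.vecCons s₀ g k.succ)) *
      w (Matrix.vecCons s₀ g (Fin.last d))

theorem chainValue_zero {S : Type*} [Fintype S] (P : Fin 0 → S → S → ℝ) (w : S → ℝ) (s₀ : S) :
    chainValue P w s₀ = w s₀ := by
  simp [chainValue]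

theorem chainValue_succ {S : Type*} [Fintype S] {d : ℕ} (P : Fin (d + 1) → S → S → ℝ)
    (w : S → ℝ) (s₀ : S) :
    chainValue P w s₀ = ∑ s, P 0 s₀ s * chainValue (fun k => P k.succ) w s := by
  simp only [chainValue]
  rw [← (Fin.consEquiv fun _ => S).sum_comp, Fintype.sum_prod_type]
  refine Finset.sum_congr rfl fun s _ => ?_
  rw [Finset.mul_sum]
  refine Finset.sum_congr rfl fun g _ => ?_
  rw [Fin.prod_univ_succ, ← mul_assoc]
  rfl

theorem chainValue_neg {S : Type*} [Fintype S] {d : ℕ} (P : Fin d → S → S → ℝ) (w : S → ℝ)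
    (s₀ : S) : chainValue P (fun s => -w s) s₀ = -chainValue P w s₀ := by
  simp [chainValue]

/-- A subsolution of the backward recursion bounds the value of the chain from below. -/
theorem le_chainValue {S : Type*} [Fintype S] {d : ℕ} {P : Fin d → S → S → ℝ} {w : S → ℝ}
    {W : Fin (d + 1) → S → ℝ} (hP : ∀ k s s', 0 ≤ P k s s') (hlast : ∀ s, W (Fin.last d) s ≤ w s)
    (hW : ∀ (k : Fin d) s, W k.castSucc s ≤ ∑ s', P k s s' * W k.succ s') (s₀ : S) :
    W 0 s₀ ≤ chainValue P w s₀ := by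
  induction d generalizing s₀ with
  | zero => rw [chainValue_zero]; exact hlast s₀
  | succ d ih =>
    rw [chainValue_succ]
    refine (hW 0 s₀).trans (Finset.sum_le_sum fun s _ => mul_le_mul_of_nonneg_left ?_ (hP 0 s₀ s))
    exact ih (W := fun k => W k.succ) (fun k => hP k.succ) hlast (fun k => hW k.succ) s

/-- A supersolution of the backward recursion bounds the value of the chain from above. -/
theorem chainValue_le {S : Type*} [Fintype S] {d : ℕ} {P : Fin d → S → S → ℝ} {w : S → ℝ}
    {W : Fin (d + 1) → S → ℝ} (hP : ∀ k s s', 0 ≤ P k s s') (hlast : ∀ s, w s ≤ W (Fin.last d) s)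
    (hW : ∀ (k : Fin d) s, ∑ s', P k s s' * W k.succ s' ≤ W k.castSucc s) (s₀ : S) :
    chainValue P w s₀ ≤ W 0 s₀ := by
  have h := le_chainValue (w := fun s => -w s) (W := fun k s => -W k s) hP
    (fun s => neg_le_neg (hlast s)) (fun k s => by simpa using hW k s) s₀
  rw [chainValue_neg] at h
  exact neg_le_neg_iff.mp h

/-- Robust dynamic programming with a minimizing adversary: the robust
backward value-iteration function `V` (with `sInf` over the feasible interval distributions)
satisfies: the supremum over all policies of the infimum over all adversaries of the
expected terminal weight from `s₀` equals `V 0 s₀`. -/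
theorem robust_dp_min {S A : Type*} [Fintype S] [Nonempty S] [Fintype A] [Nonempty A]
    (d : ℕ) (w : S → ℝ)
    (l u : Fin d → S → A → S → ℝ)
    (hlu : ∀ (k : Fin d) (s : S) (a : A) (s' : S), 0 ≤ l k s a s' ∧ l k s a s' ≤ u k s a s')
    (D : Fin d → S → A → Set (S → ℝ))
    (hD : ∀ (k : Fin d) (s : S) (a : A), D k s a =
      {p : S → ℝ | (∀ s' : S, l k s a s' ≤ p s' ∧ p s' ≤ u k s a s') ∧ ∑ s' : S, p s' = 1})
    (hDne : ∀ (k : Fin d) (s : S) (a : A), (D k s a).Nonempty)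
    (Val : (Fin d → S → A) → (Fin d → S → A → S → ℝ) → S → ℝ)
    (hVal : ∀ (σ : Fin d → S → A) (η : Fin d → S → A → S → ℝ) (s₀ : S), Val σ η s₀ =
      ∑ g : Fin d → S,
        (∏ k : Fin d,
          η k (Matrix.vecCons s₀ g k.castSucc) (σ k (Matrix.vecCons s₀ g k.castSucc))
            (Matrix.vecCons s₀ g k.succ)) *
          w (Matrix.vecCons s₀ g (Fin.last d)))
    (V : Fin (d + 1) → S → ℝ)
    (hVlast : ∀ s : S, V (Fin.last d) s = w s)
    (hVrec : ∀ (k : Fin d) (s : S),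
      V k.castSucc s = Finset.univ.sup' Finset.univ_nonempty
        (fun a : A => sInf {x : ℝ | ∃ p ∈ D k s a, x = ∑ s' : S, p s' * V k.succ s'}))
    (s₀ : S) :
    (⨆ σ : Fin d → S → A,
        ⨅ η : {η : Fin d → S → A → S → ℝ //
            ∀ (k : Fin d) (s : S) (a : A), η k s a ∈ D k s a},
          Val σ η.1 s₀)
      = V 0 s₀ := by
  have hval : ∀ σ η, Val σ η s₀ = chainValue (fun k s => η k s (σ k s)) w s₀ :=
    fun σ η => hVal σ η s₀
  have hnonneg : ∀ k s a, ∀ p ∈ D k s a, ∀ s', 0 ≤ p s' := by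
    intro k s a p hp s'
    rw [hD] at hp
    exact (hlu k s a s').1.trans (hp.1 s').1
  have hsum : ∀ k s a, ∀ p ∈ D k s a, ∑ s', p s' = 1 := by
    intro k s a p hp
    rw [hD] at hp
    exact hp.2
  have hmin : ∀ k s a, ∃ p ∈ D k s a, IsLeast
      {x : ℝ | ∃ p ∈ D k s a, x = ∑ s' : S, p s' * V k.succ s'} (∑ s', p s' * V k.succ s') := by
    intro k s a
    have hc : IsCompact (D k s a) := hD k s a ▸ isCompact_intervalDistributions _ _
    obtain ⟨p, hp, hle⟩ := hc.exists_isMinOn (hDne k s a)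
      (f := fun p => ∑ s', p s' * V k.succ s') (by fun_prop)
    refine ⟨p, hp, ⟨p, hp, rfl⟩, ?_⟩
    rintro _ ⟨q, hq, rfl⟩
    exact hle hq
  choose η' hη' hleast using hmin
  simp only [(hleast _ _ _).csInf_eq] at hVrec
  have hbdd : ∀ σ : Fin d → S → A, BddBelow (Set.range
      fun η : {η : Fin d → S → A → S → ℝ // ∀ k s a, η k s a ∈ D k s a} => Val σ η.1 s₀) := by
    intro σ
    obtain ⟨c, hc⟩ := (Set.finite_range w).bddBelow
    refine ⟨c, ?_⟩
    rintro _ ⟨η, rfl⟩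
    simp only [hval]
    refine le_chainValue (W := fun _ _ => c) (fun k s => hnonneg _ _ _ _ (η.2 _ _ _))
      (fun s => hc ⟨s, rfl⟩) (fun k s => ?_) s₀
    rw [← Finset.sum_mul, hsum _ _ _ _ (η.2 _ _ _), one_mul]
  have : Nonempty {η : Fin d → S → A → S → ℝ // ∀ k s a, η k s a ∈ D k s a} := ⟨⟨η', hη'⟩⟩
  refine le_antisymm (ciSup_le fun σ => (ciInf_le (hbdd σ) ⟨η', hη'⟩).trans ?_) ?_
  · rw [hval]
    refine chainValue_le (fun k s => hnonneg _ _ _ _ (hη' _ _ _)) (fun s => (hVlast s).ge)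
      (fun k s => ?_) s₀
    rw [hVrec]
    exact Finset.le_sup' (fun a => ∑ s', η' k s a s' * V k.succ s') (Finset.mem_univ _)
  · have hmax : ∀ (k : Fin d) (s : S), ∃ a, V k.castSucc s = ∑ s', η' k s a s' * V k.succ s' := by
      intro k s
      obtain ⟨a, -, ha⟩ := Finset.exists_mem_eq_sup' Finset.univ_nonempty
        fun a => ∑ s', η' k s a s' * V k.succ s'
      exact ⟨a, (hVrec k s).trans ha⟩
    choose σ hσ using hmax
    refine le_ciSup_of_le (Set.finite_range _).bddAbove σ (le_ciInf fun η => ?_)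
    rw [hval]
    refine le_chainValue (fun k s => hnonneg _ _ _ _ (η.2 _ _ _)) (fun s => (hVlast s).le)
      (fun k s => ?_) s₀
    rw [hσ]
    exact (hleast k s (σ k s)).2 ⟨_, η.2 _ _ _, rfl⟩
end

section
/- Conditioning by resetting (matrix-level content of Definition 8 and Lemma 1): in the conditioned chain that resets all evidence-inconsistent states to the initial state, the long-run absorption probabilities are the Bayesian conditional probabilities. Let S be a nonempty finite type, s_I ∈ S, d ≥ 1, M 1, …, M d : Matrix S S ℝ row-stochastic matrices, and L 1, …, L d ⊆ S subsets, with D i the diagonal 0/1 indicator matrix of L i. Let p : S → ℝ be p s := (M 1 * D 1 * ⋯ * M d * D d) s_I s and Z := ∑ s, p s, and assume Z > 0. Define the layered reset chain on the finite state space (Fin (d+1)) × S by the transition matrix T: for i < d, T (i, s) (i+1, s') = (M (i+1)) s s' whenever i = 0 or s ∈ L i, and T (i, s) (0, s_I) = 1 whenever i ≥ 1 and s ∉ L i; for the last layer, T (d, s) (d, s) = 1 if s ∈ L d (absorbing) and T (d, s) (0, s_I) = 1 if s ∉ L d; all other entries of T are 0. Then T is row-stochastic, and for every s ∈ L d the sequence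 n ↦ (T ^ n) (0, s_I) (d, s) converges (as n → ∞) to p s / Z. -/
open Matrix Filter

/-- The layered reset chain of Definition 8 (conditioned MDP for precise evidence), on state
space `Fin (d+1) × S`. Layers are indexed `0, …, d`; from a non-final layer `i` a state that
agrees with the evidence (always, for `i = 0`, and `s ∈ L i` for `i ≥ 1`, with `L` here
`0`-indexed as `L ⟨i-1⟩`) moves forward to layer `i+1` according to `M ⟨i⟩`, a disagreeing
state resets to `(0, s_I)` with probability one; in the final layer, agreeing states are
absorbing and disagreeing states reset. All other entries are `0`. -/
noncomputable def resetChain {S : Type*} [Fintype S] [DecidableEq S] {d : ℕ} (hd : 1 ≤ d)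
    (s_I : S) (M : Fin d → Matrix S S ℝ) (L : Fin d → Set S)
    [inst : ∀ i, DecidablePred (· ∈ L i)] :
    Matrix (Fin (d + 1) × S) (Fin (d + 1) × S) ℝ :=
  fun p q =>
    if hlt : (p.1 : ℕ) < d then
      if h0 : (p.1 : ℕ) = 0 then
        if (q.1 : ℕ) = (p.1 : ℕ) + 1 then M ⟨(p.1 : ℕ), hlt⟩ p.2 q.2 else 0
      else
        if p.2 ∈ L ⟨(p.1 : ℕ) - 1, by omega⟩ then
          if (q.1 : ℕ) = (p.1 : ℕ) + 1 then M ⟨(p.1 : ℕ), hlt⟩ p.2 q.2 else 0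
        else if q = (0, s_I) then 1 else 0
    else
      if p.2 ∈ L ⟨(p.1 : ℕ) - 1, by have := p.1.isLt; omega⟩ then
        if q = p then 1 else 0
      else if q = (0, s_I) then 1 else 0

section FiniteChain

variable {X : Type*} [Fintype X] [DecidableEq X] {T : Matrix X X ℝ}

theorem pow_apply_nonneg_of_nonneg (hT : ∀ x y, 0 ≤ T x y) (n : ℕ) (x y : X) :
    0 ≤ (T ^ n) x y := by
  induction n generalizing y with
  | zero => rw [pow_zero, Matrix.one_apply]; split_ifs <;> norm_num
  | succ n ih =>
    rw [pow_succ, Matrix.mul_apply]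
    exact Finset.sum_nonneg fun z _ => mul_nonneg (ih z) (hT z y)

theorem pow_mulVec_eq_self {h : X → ℝ} (hh : T *ᵥ h = h) (n : ℕ) : T ^ n *ᵥ h = h := by
  induction n with
  | zero => simp
  | succ n ih => rw [pow_succ, ← Matrix.mulVec_mulVec, hh, ih]

/-- If a potential `g` drops by at least one in expectation at every state outside `A`, then
the probability of being at a given state outside `A` tends to zero. -/
theorem tendsto_pow_apply_zero_of_drift (hT : ∀ x y, 0 ≤ T x y) (hrow : T *ᵥ 1 = 1)
    (A : Set X) (g : X → ℝ) (hg : ∀ x, (T *ᵥ g) x ≤ g x - Aᶜ.indicator 1 x)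
    (x : X) {y : X} (hy : y ∉ A) :
    Tendsto (fun n => (T ^ n) x y) atTop (nhds 0) := by
  have hpow := pow_apply_nonneg_of_nonneg hT
  have hmono : ∀ (n : ℕ) {u w : X → ℝ}, (∀ z, u z ≤ w z) → (T ^ n *ᵥ u) x ≤ (T ^ n *ᵥ w) x :=
    fun n u w huw => Finset.sum_le_sum fun z _ => mul_le_mul_of_nonneg_left (huw z) (hpow n x z)
  set m : ℕ → ℝ := fun n => (T ^ n *ᵥ Aᶜ.indicator 1) x with hm
  have hind : ∀ z, 0 ≤ Aᶜ.indicator (1 : X → ℝ) z :=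
    fun z => Set.indicator_nonneg (fun _ _ => zero_le_one) z
  have hm0 : ∀ n, 0 ≤ m n := fun n =>
    Finset.sum_nonneg fun z _ => mul_nonneg (hpow n x z) (hind z)
  have hstep : ∀ n, (T ^ (n + 1) *ᵥ g) x ≤ (T ^ n *ᵥ g) x - m n := by
    intro n
    have := hmono n hg
    rw [pow_succ, ← Matrix.mulVec_mulVec]
    refine this.trans_eq ?_
    change (T ^ n *ᵥ (g - Aᶜ.indicator 1)) x = _
    rw [Matrix.mulVec_sub]
    rfl
  have hsum : ∀ n, ∑ k ∈ Finset.range n, m k ≤ g x - (T ^ n *ᵥ g) x := by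
    intro n
    induction n with
    | zero => simp
    | succ n ih => rw [Finset.sum_range_succ]; linarith [hstep n]
  obtain ⟨B, hB⟩ := (Set.finite_range g).bddBelow
  have hlow : ∀ n, B ≤ (T ^ n *ᵥ g) x := by
    intro n
    have h1 := hmono n (u := B • (1 : X → ℝ)) (w := g) fun z => by
      simpa using hB (Set.mem_range_self z)
    rw [Matrix.mulVec_smul, pow_mulVec_eq_self hrow] at h1
    simpa using h1
  have hsummable : Summable m :=
    summable_of_sum_range_le hm0 fun n => (hsum n).trans (sub_le_sub_left (hlow n) _)
  refine squeeze_zero (fun n => hpow n x y) (fun n => ?_) hsummable.tendsto_atTop_zero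
  have := Finset.single_le_sum (f := fun z => (T ^ n) x z * Aᶜ.indicator 1 z)
    (fun z _ => mul_nonneg (hpow n x z) (hind z)) (Finset.mem_univ y)
  simpa [hm, Matrix.mulVec, dotProduct, hy] using this

/-- The probability of being at `y` tends to the value of a harmonic function which, on the
eventually absorbing set `A`, is the indicator of `y`. -/
theorem tendsto_pow_apply_of_harmonic (A : Set X) (x y : X)
    (hA : ∀ z ∉ A, Tendsto (fun n => (T ^ n) x z) atTop (nhds 0))
    (h : X → ℝ) (hh : T *ᵥ h = h) (hy : h y = 1) (hAy : ∀ z ∈ A, z ≠ y → h z = 0) :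
    Tendsto (fun n => (T ^ n) x y) atTop (nhds (h x)) := by
  have key : ∀ n, (T ^ n) x y = h x - ∑ z ∈ Finset.univ.erase y, (T ^ n) x z * h z := by
    intro n
    have h1 : (T ^ n *ᵥ h) x = h x := by rw [pow_mulVec_eq_self hh]
    rw [Matrix.mulVec, dotProduct, ← Finset.add_sum_erase _ _ (Finset.mem_univ y), hy] at h1
    linarith
  have hlim : Tendsto (fun n => ∑ z ∈ Finset.univ.erase y, (T ^ n) x z * h z) atTop
      (nhds (∑ z ∈ Finset.univ.erase y, 0)) := by
    refine tendsto_finsetSum _ fun z hz => ?_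
    by_cases hzA : z ∈ A
    · simp [hAy z hzA (Finset.ne_of_mem_erase hz)]
    · simpa using (hA z hzA).mul_const (h z)
  simp only [key]
  simpa using hlim.const_sub (h x)

end FiniteChain

section ResetChain

variable {S : Type*} {d : ℕ}

/-- The label of the state agrees with the observation of its layer (vacuous in layer `0`). -/
def Agrees (L : Fin d → Set S) (q : Fin (d + 1) × S) : Prop :=
  ∀ j : Fin d, q.1 = j.succ → q.2 ∈ L j

theorem agrees_succ {L : Fin d → Set S} {i : Fin d} {x : S} :
    Agrees L (i.succ, x) ↔ x ∈ L i := by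
  simp [Agrees]

theorem agrees_zero {L : Fin d → Set S} {x : S} : Agrees L (0, x) :=
  fun j hj => absurd hj (Fin.succ_ne_zero j).symm

theorem agrees_last {L : Fin d → Set S} {j : Fin d} (hj : (j : ℕ) + 1 = d) {x : S} :
    Agrees L (Fin.last d, x) ↔ x ∈ L j := by
  rw [← agrees_succ, show Fin.last d = j.succ from Fin.ext (by simp [hj])]

theorem agrees_iff_of_ne_zero {L : Fin d → Set S} {q : Fin (d + 1) × S} (hq : (q.1 : ℕ) ≠ 0) :
    Agrees L q ↔ q.2 ∈ L ⟨(q.1 : ℕ) - 1, by omega⟩ := by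
  obtain ⟨k, x⟩ := q
  obtain ⟨j, rfl⟩ := Fin.exists_succ_eq.2 fun h : k = 0 => hq (by simp [h])
  exact agrees_succ

/-- Case distinction along the three kinds of states of the reset chain. -/
theorem resetChain_cases (L : Fin d → Set S) {motive : Fin (d + 1) × S → Prop}
    (reset : ∀ q, ¬ Agrees L q → motive q)
    (forward : ∀ i x, Agrees L (Fin.castSucc i, x) → motive (i.castSucc, x))
    (last : ∀ x, Agrees L (Fin.last d, x) → motive (Fin.last d, x)) (q : Fin (d + 1) × S) :
    motive q := by
  by_cases hq : Agrees L q
  · obtain ⟨k, x⟩ := q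
    induction k using Fin.lastCases with
    | last => exact last x hq
    | cast i => exact forward i x hq
  · exact reset q hq

variable [Fintype S] [DecidableEq S]

section

variable (hd : 1 ≤ d) (s_I : S) (M : Fin d → Matrix S S ℝ) (L : Fin d → Set S)
  [inst : ∀ i, DecidablePred (· ∈ L i)]

theorem resetChain_apply_of_not_agrees {q : Fin (d + 1) × S} (hq : ¬ Agrees L q)
    (r : Fin (d + 1) × S) :
    resetChain hd s_I M L q r = if r = (0, s_I) then 1 else 0 := by
  have h0 : (q.1 : ℕ) ≠ 0 := fun h => hq fun j hj => by simp [hj] at h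
  rw [agrees_iff_of_ne_zero h0] at hq
  unfold resetChain
  simp [h0, hq]

theorem resetChain_apply_castSucc {i : Fin d} {x : S} (hq : Agrees L (i.castSucc, x))
    (r : Fin (d + 1) × S) :
    resetChain hd s_I M L (i.castSucc, x) r = if r.1 = i.succ then M i x r.2 else 0 := by
  have hr : (r.1 : ℕ) = (i : ℕ) + 1 ↔ r.1 = i.succ := by simp [Fin.ext_iff]
  unfold resetChain
  rw [dif_pos (show ((i.castSucc, x).1 : ℕ) < d by simp)]
  by_cases h0 : (i : ℕ) = 0
  · rw [dif_pos (by simpa using h0)]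
    simp [hr]
  · have := (agrees_iff_of_ne_zero (by simpa using h0)).1 hq
    simp only [Fin.val_castSucc] at this
    simp [h0, this, hr]

theorem resetChain_apply_last {x : S} (hq : Agrees L (Fin.last d, x)) (r : Fin (d + 1) × S) :
    resetChain hd s_I M L (Fin.last d, x) r = if r = (Fin.last d, x) then 1 else 0 := by
  have := (agrees_iff_of_ne_zero (by simp; omega)).1 hq
  simp only [Fin.val_last] at this
  unfold resetChain
  simp [this]

theorem resetChain_mulVec_of_not_agrees {q : Fin (d + 1) × S} (hq : ¬ Agrees L q)
    (f : Fin (d + 1) × S → ℝ) : (resetChain hd s_I M L *ᵥ f) q = f (0, s_I) := by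
  simp [Matrix.mulVec, dotProduct, resetChain_apply_of_not_agrees hd s_I M L hq]

theorem resetChain_mulVec_castSucc {i : Fin d} {x : S} (hq : Agrees L (i.castSucc, x))
    (f : Fin (d + 1) × S → ℝ) :
    (resetChain hd s_I M L *ᵥ f) (i.castSucc, x) = ∑ x', M i x x' * f (i.succ, x') := by
  simp only [Matrix.mulVec, dotProduct, resetChain_apply_castSucc hd s_I M L hq,
    Fintype.sum_prod_type]
  rw [Finset.sum_eq_single i.succ] <;> simp +contextual

theorem resetChain_mulVec_last {x : S} (hq : Agrees L (Fin.last d, x))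
    (f : Fin (d + 1) × S → ℝ) :
    (resetChain hd s_I M L *ᵥ f) (Fin.last d, x) = f (Fin.last d, x) := by
  simp [Matrix.mulVec, dotProduct, resetChain_apply_last hd s_I M L hq]

theorem resetChain_nonneg (hM : ∀ i s s', 0 ≤ M i s s') (q r : Fin (d + 1) × S) :
    0 ≤ resetChain hd s_I M L q r := by
  induction q using resetChain_cases L with
  | reset q hq => rw [resetChain_apply_of_not_agrees _ _ _ _ hq]; split_ifs <;> norm_num
  | forward i x hq =>
    rw [resetChain_apply_castSucc _ _ _ _ hq]
    split_ifs
    exacts [hM _ _ _, le_rfl]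
  | last x hq => rw [resetChain_apply_last _ _ _ _ hq]; split_ifs <;> norm_num

theorem resetChain_mulVec_one (hM : ∀ i s, ∑ s', M i s s' = 1) :
    resetChain hd s_I M L *ᵥ 1 = 1 := by
  ext q
  induction q using resetChain_cases L with
  | reset q hq => rw [resetChain_mulVec_of_not_agrees _ _ _ _ hq]; rfl
  | forward i x hq => rw [resetChain_mulVec_castSucc _ _ _ _ hq]; simp [hM]
  | last x hq => rw [resetChain_mulVec_last _ _ _ _ hq]

end

/-- The product of the filtered transition matrices from layer `k` on. -/
noncomputable def evidenceMatrix (M : Fin d → Matrix S S ℝ) (L : Fin d → Set S)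
    [inst : ∀ i, DecidablePred (· ∈ L i)] (k : ℕ) : Matrix S S ℝ :=
  ((List.ofFn fun i : Fin d =>
    M i * Matrix.diagonal fun x => if x ∈ L i then (1 : ℝ) else 0).drop k).prod

open Classical in
/-- Expected value of `t` at the final state, restricted to the evidence-consistent
continuations of `q` that never reset. -/
noncomputable def evidenceValue (M : Fin d → Matrix S S ℝ) (L : Fin d → Set S)
    [inst : ∀ i, DecidablePred (· ∈ L i)] (t : S → ℝ) (q : Fin (d + 1) × S) : ℝ :=
  if Agrees L q then (evidenceMatrix M L q.1 *ᵥ t) q.2 else 0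

variable (hd : 1 ≤ d) (s_I : S) (M : Fin d → Matrix S S ℝ) (L : Fin d → Set S)
  [inst : ∀ i, DecidablePred (· ∈ L i)]

theorem evidenceMatrix_castSucc (i : Fin d) :
    evidenceMatrix M L i = (M i * Matrix.diagonal fun x => if x ∈ L i then (1 : ℝ) else 0) *
      evidenceMatrix M L (i + 1) := by
  unfold evidenceMatrix
  rw [List.drop_eq_getElem_cons (by simp), List.prod_cons]
  simp

theorem evidenceValue_of_not_agrees (t : S → ℝ) {q : Fin (d + 1) × S} (hq : ¬ Agrees L q) :
    evidenceValue M L t q = 0 := if_neg hq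

theorem evidenceValue_zero (t : S → ℝ) (x : S) :
    evidenceValue M L t (0, x) = (evidenceMatrix M L 0 *ᵥ t) x := if_pos agrees_zero

theorem evidenceValue_last (t : S → ℝ) {x : S} (hq : Agrees L (Fin.last d, x)) :
    evidenceValue M L t (Fin.last d, x) = t x := by
  rw [evidenceValue, if_pos hq, evidenceMatrix, List.drop_of_length_le (by simp)]
  simp

theorem sum_mul_evidenceValue_succ (t : S → ℝ) {i : Fin d} {x : S}
    (hq : Agrees L (i.castSucc, x)) :
    ∑ x', M i x x' * evidenceValue M L t (i.succ, x') =
      evidenceValue M L t (i.castSucc, x) := by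
  rw [evidenceValue, if_pos hq]
  simp only [Fin.val_castSucc]
  rw [evidenceMatrix_castSucc, ← Matrix.mulVec_mulVec, ← Matrix.mulVec_mulVec]
  refine Finset.sum_congr rfl fun x' _ => ?_
  simp [evidenceValue, agrees_succ, Matrix.mulVec_diagonal]

/-- The probability of the evidence-consistent final states, normalised by the evidence
probability, extends to a harmonic function of the reset chain. -/
theorem resetChain_mulVec_harmonic (hM : ∀ i s, ∑ s', M i s s' = 1) (t : S → ℝ)
    (hZ : evidenceValue M L 1 (0, s_I) ≠ 0) :
    let c := evidenceValue M L t (0, s_I) / evidenceValue M L 1 (0, s_I)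
    let h := fun q => evidenceValue M L t q + (1 - evidenceValue M L 1 q) * c
    resetChain hd s_I M L *ᵥ h = h ∧ h (0, s_I) = c := by
  intro c h
  have h0 : h (0, s_I) = c := by
    simp only [h, c]
    field_simp
    ring
  refine ⟨?_, h0⟩
  ext q
  induction q using resetChain_cases L with
  | reset q hq =>
    rw [resetChain_mulVec_of_not_agrees _ _ _ _ hq, h0]
    simp [h, evidenceValue_of_not_agrees M L _ hq]
  | forward i x hq =>
    rw [resetChain_mulVec_castSucc _ _ _ _ hq]
    simp only [h, ← sum_mul_evidenceValue_succ M L _ hq, mul_add, sub_mul, mul_sub, one_mul,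
      Finset.sum_add_distrib, Finset.sum_sub_distrib, Finset.sum_mul, ← mul_assoc]
    rw [← Finset.sum_mul, hM, one_mul]
  | last x hq => rw [resetChain_mulVec_last _ _ _ _ hq]

/-- The set of absorbing states of the reset chain. -/
def absorbingStates (L : Fin d → Set S) : Set (Fin (d + 1) × S) :=
  {q | q.1 = Fin.last d ∧ Agrees L q}

open Classical in
/-- The reset chain admits a potential dropping by one at every non-absorbing state. -/
theorem exists_resetChain_drift (hMnn : ∀ i s s', 0 ≤ M i s s')
    (hM : ∀ i s, ∑ s', M i s s' = 1) (hZ : 0 < evidenceValue M L 1 (0, s_I)) :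
    ∃ g : Fin (d + 1) × S → ℝ, ∀ q, (resetChain hd s_I M L *ᵥ g) q ≤
      g q - (absorbingStates L)ᶜ.indicator 1 q := by
  set Z := evidenceValue M L 1 (0, s_I)
  let K : ℝ := (d + 1) / Z
  let u : Fin (d + 1) × S → ℝ := fun q =>
    if q ∈ absorbingStates L then 0 else d + 1 - (q.1 : ℕ)
  have hu : ∀ q, u q ≤ d + 1 - (q.1 : ℕ) := by
    intro q
    have : ((q.1 : ℕ) : ℝ) ≤ d := by exact_mod_cast q.1.is_le
    simp only [u]
    split_ifs <;> linarith
  refine ⟨fun q => u q + (1 - evidenceValue M L 1 q) * K, fun q => ?_⟩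
  induction q using resetChain_cases L with
  | reset q hq =>
    have hqA : q ∉ absorbingStates L := fun h => hq h.2
    have hK : Z * K = d + 1 := mul_div_cancel₀ _ hZ.ne'
    have h1 : ((q.1 : ℕ) : ℝ) ≤ d := by exact_mod_cast q.1.is_le
    have h2 := hu (0, s_I)
    have h3 : u q = d + 1 - (q.1 : ℕ) := if_neg hqA
    rw [resetChain_mulVec_of_not_agrees _ _ _ _ hq]
    beta_reduce
    rw [evidenceValue_of_not_agrees M L _ hq, h3, Set.indicator_of_mem hqA]
    simp only [Pi.one_apply, Fin.val_zero, Nat.cast_zero] at h2 ⊢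
    change u (0, s_I) + (1 - Z) * K ≤ _
    linarith
  | forward i x hq =>
    have hqA : (i.castSucc, x) ∉ absorbingStates L := fun h => (Fin.castSucc_lt_last i).ne h.1
    have h3 : u (i.castSucc, x) = d + 1 - (i : ℕ) := if_neg hqA
    have h4 : ∑ x', M i x x' * u (i.succ, x') ≤ d - (i : ℕ) :=
      calc ∑ x', M i x x' * u (i.succ, x') ≤ ∑ x', M i x x' * (d - (i : ℕ)) := by
            refine Finset.sum_le_sum fun x' _ => mul_le_mul_of_nonneg_left ?_ (hMnn _ _ _)
            have := hu (i.succ, x')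
            simp only [Fin.val_succ, Nat.cast_add, Nat.cast_one] at this
            linarith
        _ = d - (i : ℕ) := by rw [← Finset.sum_mul, hM, one_mul]
    have h5 : ∑ x', M i x x' * ((1 - evidenceValue M L 1 (i.succ, x')) * K) =
        (1 - evidenceValue M L 1 (i.castSucc, x)) * K := by
      simp only [← mul_assoc, ← Finset.sum_mul, mul_sub, mul_one, Finset.sum_sub_distrib, hM,
        sum_mul_evidenceValue_succ M L _ hq]
    rw [resetChain_mulVec_castSucc _ _ _ _ hq]
    beta_reduce
    rw [h3, Set.indicator_of_mem hqA]
    simp only [mul_add, Finset.sum_add_distrib, h5, Pi.one_apply]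
    linarith
  | last x hq =>
    have hqA : (Fin.last d, x) ∈ absorbingStates L := ⟨rfl, hq⟩
    rw [resetChain_mulVec_last _ _ _ _ hq, Set.indicator_of_notMem (by simpa using hqA)]
    simp

end ResetChain

/-- Conditioning by resetting (Definition 8 and Lemma 1): the layered reset
chain `T` is row-stochastic, and for every evidence-consistent final state `s ∈ L d` the
probability `(T ^ n) (0, s_I) (d, s)` converges, as `n → ∞`, to the Bayesian conditional
probability `p s / Z` of ending the evidence in `s`. -/
theorem conditioned_reset_chain {S : Type*} [Fintype S] [Nonempty S] [DecidableEq S]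
    (s_I : S) {d : ℕ} (hd : 1 ≤ d)
    (M : Fin d → Matrix S S ℝ)
    (hMnn : ∀ i : Fin d, ∀ s s' : S, 0 ≤ M i s s')
    (hMrow : ∀ i : Fin d, ∀ s : S, ∑ s' : S, M i s s' = 1)
    (L : Fin d → Set S) [inst : ∀ i, DecidablePred (· ∈ L i)]
    (p : S → ℝ)
    (hp : ∀ s : S, p s = (List.ofFn fun i : Fin d =>
        M i * Matrix.diagonal fun x => if x ∈ L i then (1 : ℝ) else 0).prod s_I s)
    (Z : ℝ) (hZdef : Z = ∑ s : S, p s) (hZ : 0 < Z)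
    (T : Matrix (Fin (d + 1) × S) (Fin (d + 1) × S) ℝ)
    (hT : T = resetChain hd s_I M L) :
    ((∀ x y : Fin (d + 1) × S, 0 ≤ T x y) ∧ ∀ x : Fin (d + 1) × S, ∑ y, T x y = 1) ∧
      ∀ s : S, s ∈ L ⟨d - 1, by omega⟩ →
        Tendsto (fun n : ℕ => (T ^ n) (0, s_I) (Fin.last d, s)) atTop (nhds (p s / Z)) := by
  have hnn := resetChain_nonneg hd s_I M L hMnn
  have hone := resetChain_mulVec_one hd s_I M L hMrow
  rw [← hT] at hnn hone
  refine ⟨⟨hnn, fun x => by simpa [Matrix.mulVec, dotProduct] using congrFun hone x⟩,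
    fun s hs => ?_⟩
  have hp' : ∀ s, p s = evidenceMatrix M L 0 s_I s := fun s => by simp [hp, evidenceMatrix]
  have hZ' : evidenceValue M L 1 (0, s_I) = Z := by
    simp [evidenceValue_zero, Matrix.mulVec, dotProduct, hZdef, hp']
  have hps : evidenceValue M L (Pi.single s 1) (0, s_I) = p s := by
    simp [evidenceValue_zero, hp']
  obtain ⟨g, hg⟩ := exists_resetChain_drift hd s_I M L hMnn hMrow (hZ' ▸ hZ)
  obtain ⟨hharm, hinit⟩ := resetChain_mulVec_harmonic hd s_I M L hMrow (Pi.single s 1)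
    (hZ' ▸ hZ.ne')
  rw [← hT] at hg hharm
  rw [← hps, ← hZ', ← hinit]
  have hlast := (agrees_last (by simp; omega)).2 hs
  refine tendsto_pow_apply_of_harmonic (absorbingStates L) _ _
    (fun z hz => tendsto_pow_apply_zero_of_drift hnn hone _ g hg _ hz) _ hharm ?_ ?_
  · simp [evidenceValue_last M L _ hlast]
  · rintro ⟨k, x⟩ ⟨rfl, hx⟩ hne
    have hxs : x ≠ s := fun h => hne (by rw [h])
    simp [evidenceValue_last M L _ hx, hxs]
end
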